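/- arXiv:1611.05273 — 6 statements merged into one kernel-verified Lean document; each statement's English description precedes it below -/
import Mathlib

section
/- Let l > 1, c₀ > 0, M₁ ≥ 0 and T > 0. Suppose J : [0,T) → ℝ is differentiable and nondecreasing with J(0) = 0, and for every t ∈ [0,T) with c₀·J(t) − M₁ ≥ 0 one has J'(t) ≥ (c₀·J(t) − M₁)^l. Then there exists s > 0 such that J(t) ≤ s·(T−t)^{−1/(l−1)} for all t ∈ [0,T). -/
open Set

/-- A positive function on `[t, T)` satisfying `c * y ^ (p + 1) ≤ y'` with `p > 0` obeys the
blow-up rate `y t ≤ (p * c * (T - t)) ^ (-(1 / p))`. -/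
theorem le_rpow_of_rpow_le_deriv {p c t T : ℝ} {y : ℝ → ℝ} (hp : 0 < p) (hc : 0 < c)
    (htT : t < T) (hy : ∀ τ ∈ Ico t T, DifferentiableAt ℝ y τ) (hpos : ∀ τ ∈ Ico t T, 0 < y τ)
    (hode : ∀ τ ∈ Ico t T, c * y τ ^ (p + 1) ≤ deriv y τ) :
    y t ≤ (p * c * (T - t)) ^ (-(1 / p)) := by
  have hder : ∀ τ ∈ Ico t T, HasDerivAt (fun τ => y τ ^ (-p) + p * c * τ)
      (deriv y τ * (-p) * y τ ^ (-p - 1) + p * c * 1) τ := fun τ hτ =>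
    ((hy τ hτ).hasDerivAt.rpow_const (Or.inl (hpos τ hτ).ne')).add
      ((hasDerivAt_id τ).const_mul (p * c))
  have hanti : AntitoneOn (fun τ => y τ ^ (-p) + p * c * τ) (Ico t T) := by
    refine antitoneOn_of_deriv_nonpos (convex_Ico t T)
      (fun τ hτ => (hder τ hτ).continuousAt.continuousWithinAt)
      (fun τ hτ => (hder τ (interior_subset hτ)).differentiableAt.differentiableWithinAt)
      fun τ hτ => ?_
    replace hτ := interior_subset hτ
    rw [(hder τ hτ).deriv]
    have hpow : y τ ^ (p + 1) * y τ ^ (-p - 1) = 1 := by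
      rw [← Real.rpow_add (hpos τ hτ)]
      ring_nf
      exact Real.rpow_zero _
    have hmul : c ≤ deriv y τ * y τ ^ (-p - 1) := by
      calc c = c * y τ ^ (p + 1) * y τ ^ (-p - 1) := by rw [mul_assoc, hpow, mul_one]
        _ ≤ _ := mul_le_mul_of_nonneg_right (hode τ hτ) (Real.rpow_nonneg (hpos τ hτ).le _)
    nlinarith [mul_le_mul_of_nonneg_left hmul hp.le]
  have hyt : 0 < y t := hpos t ⟨le_rfl, htT⟩
  have hpc : 0 < p * c := mul_pos hp hc
  have hT : T ≤ t + y t ^ (-p) / (p * c) := by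
    refine le_of_forall_lt_imp_le_of_dense fun τ hτ => ?_
    rcases le_total τ t with h | h
    · have := div_pos (Real.rpow_pos_of_pos hyt (-p)) hpc
      linarith
    · have hle := hanti ⟨le_rfl, htT⟩ ⟨h, hτ⟩ h
      have := Real.rpow_pos_of_pos (hpos τ ⟨h, hτ⟩) (-p)
      rw [← sub_le_iff_le_add', le_div_iff₀ hpc]
      simp only at hle
      linarith
  have hle : p * c * (T - t) ≤ y t ^ (-p) := by
    rw [← sub_le_iff_le_add', le_div_iff₀ hpc] at hT
    linarith
  calc y t = (y t ^ (-p)) ^ (-(1 / p)) := by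
        rw [← Real.rpow_mul hyt.le, neg_mul_neg, mul_one_div_cancel hp.ne', Real.rpow_one]
    _ ≤ _ := Real.rpow_le_rpow_of_nonpos (mul_pos hpc (sub_pos.2 htT)) hle
        (neg_nonpos.2 (one_div_pos.2 hp).le)

/-- ODE core of Lemma 4.1: if `J` is differentiable and nondecreasing on `[0,T)` with
`J 0 = 0` and `J' t ≥ (c₀ J t - M₁)^l` whenever `c₀ J t - M₁ ≥ 0`, then
`J t ≤ s (T - t)^{-1/(l-1)}` for some `s > 0`. -/
theorem stmt0 (l c₀ M₁ T : ℝ) (hl : 1 < l) (hc₀ : 0 < c₀) (hM₁ : 0 ≤ M₁) (hT : 0 < T)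
    (J : ℝ → ℝ)
    (hdiff : ∀ t ∈ Ico (0 : ℝ) T, DifferentiableAt ℝ J t)
    (hmono : MonotoneOn J (Ico (0 : ℝ) T))
    (hJ0 : J 0 = 0)
    (hode : ∀ t ∈ Ico (0 : ℝ) T, 0 ≤ c₀ * J t - M₁ →
      (c₀ * J t - M₁) ^ l ≤ deriv J t) :
    ∃ s > 0, ∀ t ∈ Ico (0 : ℝ) T, J t ≤ s * (T - t) ^ (-(1 / (l - 1))) := by
  have hp : 0 < l - 1 := sub_pos.2 hl
  have hK : 0 < ((l - 1) * c₀) ^ (-(1 / (l - 1))) := Real.rpow_pos_of_pos (mul_pos hp hc₀) _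
  have hTpow : 0 < T ^ (1 / (l - 1)) := Real.rpow_pos_of_pos hT _
  refine ⟨(M₁ * T ^ (1 / (l - 1)) + ((l - 1) * c₀) ^ (-(1 / (l - 1)))) / c₀, by positivity,
    fun t ht => ?_⟩
  have htT : 0 < T - t := sub_pos.2 ht.2
  have hR : 0 < (T - t) ^ (-(1 / (l - 1))) := Real.rpow_pos_of_pos htT _
  have hone : 1 ≤ T ^ (1 / (l - 1)) * (T - t) ^ (-(1 / (l - 1))) := by
    rw [Real.rpow_neg htT.le, ← div_eq_mul_inv, one_le_div (Real.rpow_pos_of_pos htT _)]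
    exact Real.rpow_le_rpow htT.le (by linarith [ht.1]) (one_div_pos.2 hp).le
  have hM : M₁ ≤ M₁ * (T ^ (1 / (l - 1)) * (T - t) ^ (-(1 / (l - 1)))) :=
    le_mul_of_one_le_right hM₁ hone
  have hbound : c₀ * J t - M₁ ≤
      ((l - 1) * c₀) ^ (-(1 / (l - 1))) * (T - t) ^ (-(1 / (l - 1))) := by
    rcases le_or_gt (c₀ * J t - M₁) 0 with hneg | hpos
    · exact hneg.trans (mul_pos hK hR).le
    rw [← Real.mul_rpow (mul_pos hp hc₀).le htT.le]
    have hmem : ∀ τ ∈ Ico t T, τ ∈ Ico 0 T := fun τ hτ => ⟨ht.1.trans hτ.1, hτ.2⟩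
    have hposτ : ∀ τ ∈ Ico t T, 0 < c₀ * J τ - M₁ := fun τ hτ => by
      have := mul_le_mul_of_nonneg_left (hmono ht (hmem τ hτ) hτ.1) hc₀.le
      linarith
    have hderiv : ∀ τ ∈ Ico t T,
        HasDerivAt (fun τ => c₀ * J τ - M₁) (c₀ * deriv J τ) τ := fun τ hτ =>
      ((hdiff τ (hmem τ hτ)).hasDerivAt.const_mul c₀).sub_const M₁
    refine le_rpow_of_rpow_le_deriv (y := fun τ => c₀ * J τ - M₁) hp hc₀ ht.2
      (fun τ hτ => (hderiv τ hτ).differentiableAt) hposτ fun τ hτ => ?_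
    rw [(hderiv τ hτ).deriv, sub_add_cancel]
    exact mul_le_mul_of_nonneg_left (hode τ (hmem τ hτ) (hposτ τ hτ).le) hc₀.le
  rw [div_mul_eq_mul_div, le_div_iff₀ hc₀]
  linarith
end

section
/- Let l > 1, a ≥ 0, t₃ ∈ ℝ, and let σ : [t₃,∞) → ℝ be continuous with σ(t) → ∞ as t → ∞. Then there is no differentiable function W : [t₃,∞) → ℝ such that W(t) > 0 for all t ≥ t₃, W(t) → ∞ as t → ∞, and W'(t) ≥ σ(t)·W(t)^l − a·W(t) for all t ≥ t₃. -/
open Set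

/-- Final ODE blow-up argument in Theorem 3.5 (Th13): if `σ` is continuous on `[t₃,∞)` with
`σ(t) → ∞`, there is no positive differentiable `W` on `[t₃,∞)` with `W(t) → ∞` and
`W' t ≥ σ t * W t ^ l - a * W t`. -/
theorem stmt3 (l a t₃ : ℝ) (hl : 1 < l) (ha : 0 ≤ a)
    (σ : ℝ → ℝ) (hσc : ContinuousOn σ (Ici t₃))
    (hσ : Filter.Tendsto σ Filter.atTop Filter.atTop) :
    ¬ ∃ W : ℝ → ℝ,
      (∀ t ∈ Ici t₃, DifferentiableAt ℝ W t) ∧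
      (∀ t ∈ Ici t₃, 0 < W t) ∧
      Filter.Tendsto W Filter.atTop Filter.atTop ∧
      (∀ t ∈ Ici t₃, σ t * W t ^ l - a * W t ≤ deriv W t) := by
  rintro ⟨W, hd, hpos, hW, hineq⟩
  obtain ⟨T, hT⟩ := Filter.eventually_atTop.1 ((hW.eventually_ge_atTop 1).and
    ((hσ.eventually_ge_atTop (a + 1)).and (Filter.eventually_ge_atTop t₃)))
  have hderiv : ∀ t, T ≤ t → HasDerivAt (fun s => W s ^ (1 - l))
      (deriv W t * (1 - l) * W t ^ (1 - l - 1)) t := fun t ht =>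
    (hd t (hT t ht).2.2).hasDerivAt.rpow_const (Or.inl (hpos t (hT t ht).2.2).ne')
  have hbound : ∀ t, T ≤ t → deriv W t * (1 - l) * W t ^ (1 - l - 1) ≤ 1 - l := by
    intro t ht
    obtain ⟨h1, h2, h3⟩ := hT t ht
    have hWt := hpos t h3
    have hWl : W t ≤ W t ^ l := Real.self_le_rpow_of_one_le h1 hl.le
    have hge : W t ^ l ≤ deriv W t := by
      have := hineq t h3
      nlinarith [mul_le_mul_of_nonneg_left hWl ha,
        mul_le_mul_of_nonneg_right h2 (Real.rpow_nonneg hWt.le l)]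
    have hprod : W t ^ l * W t ^ (1 - l - 1) = 1 := by
      rw [← Real.rpow_add hWt]
      simp
    nlinarith [mul_le_mul_of_nonneg_right hge (Real.rpow_nonneg hWt.le (1 - l - 1))]
  have hVT : 0 < W T ^ (1 - l) := Real.rpow_pos_of_pos (hpos T (hT T le_rfl).2.2) _
  set s := T + W T ^ (1 - l) / (l - 1) with hs
  have hTs : T ≤ s := le_add_of_nonneg_right (div_nonneg hVT.le (by linarith))
  have hdecay := (convex_Icc T s).image_sub_le_mul_sub_of_deriv_le
    (f := fun t => W t ^ (1 - l)) (C := 1 - l)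
    (fun t ht => (hderiv t ht.1).continuousAt.continuousWithinAt)
    (fun t ht => (hderiv t (interior_subset ht).1).differentiableAt.differentiableWithinAt)
    (fun t ht => (hderiv t (interior_subset ht).1).deriv.trans_le
      (hbound t (interior_subset ht).1))
    T (left_mem_Icc.2 hTs) s (right_mem_Icc.2 hTs) hTs
  have hVs : 0 < W s ^ (1 - l) := Real.rpow_pos_of_pos (hpos s (hT s hTs).2.2) _
  have hlen : (l - 1) * (s - T) = W T ^ (1 - l) := by
    rw [hs, add_sub_cancel_left, mul_div_cancel₀ _ (by linarith)]
  linarith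
end

section
/- Let α > 0, γ > 0, 0 < ε < ω, and q > 1. Then ∫₀^{(ω−ε)/α} ((α·s+ε)^{−γ} − ω^{−γ})^{q/γ} ds ≤ (ε^{−(q−1)} − ω^{−(q−1)}) / (α·(q−1)). -/
open Set

/-- Dropping the nonnegative subtrahend `w ^ (-γ)` from `(x ^ (-γ) - w ^ (-γ)) ^ (q / γ)`. -/
lemma rpow_neg_sub_rpow_neg_rpow_div_le {γ q x w : ℝ} (hγ : 0 < γ) (hq : 0 ≤ q) (hx : 0 < x)
    (hxw : x ≤ w) : (x ^ (-γ) - w ^ (-γ)) ^ (q / γ) ≤ x ^ (-q) := by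
  have hle : w ^ (-γ) ≤ x ^ (-γ) := Real.rpow_le_rpow_of_nonpos hx hxw (by linarith)
  calc (x ^ (-γ) - w ^ (-γ)) ^ (q / γ) ≤ (x ^ (-γ)) ^ (q / γ) :=
        Real.rpow_le_rpow (sub_nonneg.2 hle)
          (sub_le_self _ (Real.rpow_nonneg (hx.le.trans hxw) _)) (by positivity)
    _ = x ^ (-q) := by
        rw [← Real.rpow_mul hx.le]
        congr 1
        field_simp

/-- Integral estimate in Theorem 2.3 (with `q = βl`):
`∫₀^{(ω-ε)/α} ((αs+ε)^{-γ} - ω^{-γ})^{q/γ} ds ≤ (ε^{-(q-1)} - ω^{-(q-1)}) / (α (q-1))`. -/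
theorem stmt10 (α γ ε ω q : ℝ) (hα : 0 < α) (hγ : 0 < γ) (hε : 0 < ε) (hεω : ε < ω)
    (hq : 1 < q) :
    (∫ s in (0 : ℝ)..((ω - ε) / α), ((α * s + ε) ^ (-γ) - ω ^ (-γ)) ^ (q / γ)) ≤
      (ε ^ (-(q - 1)) - ω ^ (-(q - 1))) / (α * (q - 1)) := by
  have hT : 0 ≤ (ω - ε) / α := div_nonneg (by linarith) hα.le
  have hpos : ∀ s ∈ Icc 0 ((ω - ε) / α), 0 < α * s + ε := fun s hs => by
    have := mul_nonneg hα.le hs.1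
    linarith
  have hcont (r : ℝ) : ContinuousOn (fun s => (α * s + ε) ^ r) (Icc 0 ((ω - ε) / α)) :=
    ContinuousOn.rpow_const (by fun_prop) fun s hs => Or.inl (hpos s hs).ne'
  have hint : ∫ s in (0 : ℝ)..((ω - ε) / α), (α * s + ε) ^ (-q) =
      (ε ^ (-(q - 1)) - ω ^ (-(q - 1))) / (α * (q - 1)) := by
    rw [intervalIntegral.integral_comp_mul_add (fun x => x ^ (-q)) hα.ne' ε, mul_zero, zero_add,
      mul_div_cancel₀ _ hα.ne', sub_add_cancel, integral_rpow, smul_eq_mul,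
      show -q + 1 = -(q - 1) by ring]
    · have : q - 1 ≠ 0 := by linarith
      field_simp
      ring
    · refine Or.inr ⟨by linarith, ?_⟩
      rw [uIcc_of_le hεω.le]
      exact fun h => hε.not_ge h.1
  rw [← hint]
  refine intervalIntegral.integral_mono_on hT ?_ ?_ fun s hs => ?_
  · refine ContinuousOn.intervalIntegrable_of_Icc hT ?_
    exact ((hcont _).sub continuousOn_const).rpow_const fun s _ => Or.inr (by positivity)
  · exact (hcont _).intervalIntegrable_of_Icc hT
  · refine rpow_neg_sub_rpow_neg_rpow_div_le hγ (by linarith) (hpos s hs) ?_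
    have := (le_div_iff₀ hα).1 hs.2
    linarith
end

section
/- Let l > 1, σ > 2/(l−1), γ > 0, k₁ > 0 and t₂ > 0. Then there exists δ ∈ (0,t₂) such that for every t with t₂ − δ < t < t₂ one has σ·(t₂−t)^{−σ−1} ≤ k₁·∫₀^{γ} (t₂+s−t)^{−σ·l} ds. -/
open Set

/-- Restricting the integral to `[0, τ]`, where the integrand is at least `(2τ)^{-m}`, bounds it
from below. -/
theorem mul_two_mul_rpow_neg_le_integral {m τ γ : ℝ} (hm : 0 ≤ m) (hτ : 0 < τ) (hτγ : τ ≤ γ) :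
    τ * (2 * τ) ^ (-m) ≤ ∫ s in (0 : ℝ)..γ, (τ + s) ^ (-m) := by
  have hint : ∀ b, 0 ≤ b →
      IntervalIntegrable (fun s : ℝ => (τ + s) ^ (-m)) MeasureTheory.volume 0 b := by
    intro b hb
    refine ContinuousOn.intervalIntegrable fun s hs => ?_
    rw [uIcc_of_le hb] at hs
    have : τ + s ≠ 0 := by linarith [hs.1]
    exact (ContinuousAt.rpow_const (by fun_prop) (Or.inl this)).continuousWithinAt
  calc τ * (2 * τ) ^ (-m) = ∫ _ in (0 : ℝ)..τ, (2 * τ) ^ (-m) := by simp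
    _ ≤ ∫ s in (0 : ℝ)..τ, (τ + s) ^ (-m) := by
      refine intervalIntegral.integral_mono_on hτ.le (by simp) (hint τ hτ.le) fun s hs => ?_
      exact Real.rpow_le_rpow_of_nonpos (by linarith [hs.1]) (by linarith [hs.2]) (by linarith)
    _ ≤ ∫ s in (0 : ℝ)..γ, (τ + s) ^ (-m) := by
      refine intervalIntegral.integral_mono_interval le_rfl hτ.le hτγ ?_ (hint γ (hτ.le.trans hτγ))
      filter_upwards [MeasureTheory.ae_restrict_mem measurableSet_Ioc] with s hs
      exact Real.rpow_nonneg (by linarith [hs.1]) _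

/-- Nonlocal boundary inequality for the blow-up subsolution `ψ(s,t) = (t₂+s-t)^{-σ}` in
Theorem 2.4 (Th10): for `σ > 2/(l-1)` there is `δ ∈ (0,t₂)` such that for all
`t ∈ (t₂-δ, t₂)`, `σ (t₂-t)^{-σ-1} ≤ k₁ ∫₀^γ (t₂+s-t)^{-σl} ds`. -/
theorem stmt12 (l σ γ k₁ t₂ : ℝ) (hl : 1 < l) (hσ : 2 / (l - 1) < σ) (hγ : 0 < γ)
    (hk₁ : 0 < k₁) (ht₂ : 0 < t₂) :
    ∃ δ, 0 < δ ∧ δ < t₂ ∧ ∀ t, t₂ - δ < t → t < t₂ →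
      σ * (t₂ - t) ^ (-σ - 1) ≤ k₁ * ∫ s in (0 : ℝ)..γ, (t₂ + s - t) ^ (-(σ * l)) := by
  have hl' : 0 < l - 1 := sub_pos.2 hl
  have hσ0 : 0 < σ := (by positivity : 0 < 2 / (l - 1)).trans hσ
  have hexp : 2 + σ - σ * l < 0 := by
    have := (div_lt_iff₀ hl').1 hσ
    linarith
  have hC : 0 < k₁ * 2 ^ (-(σ * l)) := by positivity
  obtain ⟨ε, hε, hεC⟩ := mem_nhdsGT_iff_exists_Ioo_subset.1
    ((tendsto_rpow_neg_nhdsGT_zero hexp).eventually_ge_atTop (σ / (k₁ * 2 ^ (-(σ * l)))))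
  have hε0 : 0 < ε := hε
  refine ⟨min ε (min γ (t₂ / 2)), by positivity, ?_, fun t ht htt₂ => ?_⟩
  · exact ((min_le_right _ _).trans (min_le_right _ _)).trans_lt (half_lt_self ht₂)
  obtain ⟨τ, rfl⟩ : ∃ τ, t = t₂ - τ := ⟨t₂ - t, by ring⟩
  have hτ : 0 < τ := by linarith
  obtain ⟨hτε, hτγ, -⟩ : τ < ε ∧ τ < γ ∧ τ < t₂ / 2 := by
    simpa only [lt_min_iff] using (by linarith : τ < min ε (min γ (t₂ / 2)))
  have hpow : σ / (k₁ * 2 ^ (-(σ * l))) ≤ τ ^ (2 + σ - σ * l) := hεC ⟨hτ, hτε⟩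
  rw [div_le_iff₀ hC] at hpow
  have hshift : ∀ s, t₂ + s - (t₂ - τ) = τ + s := fun s => by ring
  simp only [hshift, sub_sub_cancel]
  calc σ * τ ^ (-σ - 1)
      ≤ τ ^ (2 + σ - σ * l) * (k₁ * 2 ^ (-(σ * l))) * τ ^ (-σ - 1) := by gcongr
    _ = k₁ * (τ * (2 * τ) ^ (-(σ * l))) := by
      have hsum : τ ^ (2 + σ - σ * l) * τ ^ (-σ - 1) = τ * τ ^ (-(σ * l)) := by
        rw [← Real.rpow_add hτ, ← Real.rpow_one_add' hτ.le (by linarith)]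
        ring_nf
      rw [Real.mul_rpow zero_le_two hτ.le]
      linear_combination k₁ * 2 ^ (-(σ * l)) * hsum
    _ ≤ k₁ * ∫ s in (0 : ℝ)..γ, (τ + s) ^ (-(σ * l)) := by
      gcongr
      exact mul_two_mul_rpow_neg_le_integral (by positivity) hτ hτγ.le
end

section
/- Let n ≥ 1, l > 1, c₂ > 0, c₃ > 0 and T ∈ ℝ, and let f : ℝⁿ → ℝ be twice continuously differentiable. For x ∈ ℝⁿ and t < T with f(x) > 0, define w(x,t) = c₃·(f(x) + c₂·(T−t))^{−1/(l−1)}. Then at every such point, ∂w/∂t(x,t) − Δₓw(x,t) = (w(x,t) / ((l−1)·(f(x)+c₂(T−t)))) · ( c₂ + Δf(x) − (l/(l−1))·‖∇f(x)‖² / (f(x)+c₂(T−t)) ). In particular, if moreover Δf(x) − (l/(l−1))·‖∇f(x)‖²/f(x) ≥ −c₂, then ∂w/∂t(x,t) − Δₓw(x,t) ≥ 0. -/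
open Set

/-- The Euclidean Laplacian of `g : ℝⁿ → ℝ` at `x`: the sum of the unmixed second partial
derivatives, i.e. the sum over the coordinate directions `i` of the second derivative of the
one-variable slice `r ↦ g (x + r • eᵢ)` at `r = 0`. -/
noncomputable def euclLaplacian {n : ℕ} (g : EuclideanSpace ℝ (Fin n) → ℝ)
    (x : EuclideanSpace ℝ (Fin n)) : ℝ :=
  ∑ i : Fin n, iteratedDeriv 2 (fun r : ℝ => g (x + r • EuclideanSpace.single i (1 : ℝ))) 0

/-- Second derivative of a real power of a positive `C²` function of one variable. -/
theorem iteratedDeriv_two_const_mul_add_rpow {φ : ℝ → ℝ} (hφ : ContDiff ℝ 2 φ) (c a p r : ℝ)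
    (hpos : 0 < φ r + a) :
    iteratedDeriv 2 (fun s => c * (φ s + a) ^ p) r =
      c * p * (φ r + a) ^ (p - 1) *
        (iteratedDeriv 2 φ r + (p - 1) * deriv φ r ^ 2 / (φ r + a)) := by
  have hd (s : ℝ) : HasDerivAt (fun s => φ s + a) (deriv φ s) s :=
    ((hφ.differentiable (by norm_num)) s).hasDerivAt.add_const a
  have hd' : HasDerivAt (deriv φ) (iteratedDeriv 2 φ r) r := by
    have h := (hφ.differentiable_iteratedDeriv 1 (by norm_num)) r
    rw [iteratedDeriv_one] at h
    simpa [iteratedDeriv_succ, iteratedDeriv_zero] using h.hasDerivAt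
  have hev : ∀ᶠ s in nhds r, 0 < φ s + a :=
    (hd r).continuousAt.eventually (lt_mem_nhds hpos)
  have hfirst : deriv (fun s => c * (φ s + a) ^ p) =ᶠ[nhds r]
      fun s => c * (deriv φ s * p * (φ s + a) ^ (p - 1)) := by
    filter_upwards [hev] with s hs
    exact (((hd s).rpow_const (Or.inl hs.ne')).const_mul c).deriv
  have hsecond := ((hd'.mul_const p).mul
    ((hd r).rpow_const (p := p - 1) (Or.inl hpos.ne'))).const_mul c
  rw [iteratedDeriv_succ, iteratedDeriv_one, hfirst.deriv_eq]
  refine hsecond.deriv.trans ?_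
  rw [Real.rpow_sub_one hpos.ne' (p - 1)]
  field_simp

/-- The squared norm of the gradient is the sum of the squared partial derivatives. -/
theorem norm_gradient_sq_eq_sum_deriv {n : ℕ} {f : EuclideanSpace ℝ (Fin n) → ℝ}
    {x : EuclideanSpace ℝ (Fin n)} (hf : DifferentiableAt ℝ f x) :
    ‖gradient f x‖ ^ 2 =
      ∑ i, deriv (fun r : ℝ => f (x + r • EuclideanSpace.single i (1 : ℝ))) 0 ^ 2 := by
  rw [EuclideanSpace.norm_sq_eq]
  refine Finset.sum_congr rfl fun i _ => ?_
  have hcoord : gradient f x i = fderiv ℝ f x (EuclideanSpace.single i (1 : ℝ)) := by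
    rw [← InnerProductSpace.toDual_symm_apply (𝕜 := ℝ), EuclideanSpace.inner_single_right]
    simp [gradient]
  have hline : deriv (fun r : ℝ => f (x + r • EuclideanSpace.single i (1 : ℝ))) 0 =
      fderiv ℝ f x (EuclideanSpace.single i (1 : ℝ)) :=
    hf.lineDeriv_eq_fderiv
  rw [hline, hcoord, Real.norm_eq_abs, sq_abs]

/-- The Laplacian of a real power of a positive `C²` function. -/
theorem euclLaplacian_const_mul_add_rpow {n : ℕ} {f : EuclideanSpace ℝ (Fin n) → ℝ}
    (hf : ContDiff ℝ 2 f) (c a p : ℝ) (x : EuclideanSpace ℝ (Fin n)) (hpos : 0 < f x + a) :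
    euclLaplacian (fun y => c * (f y + a) ^ p) x =
      c * p * (f x + a) ^ (p - 1) *
        (euclLaplacian f x + (p - 1) * ‖gradient f x‖ ^ 2 / (f x + a)) := by
  rw [norm_gradient_sq_eq_sum_deriv (hf.differentiable (by norm_num) x)]
  simp only [euclLaplacian]
  rw [Finset.mul_sum, Finset.sum_div, ← Finset.sum_add_distrib, Finset.mul_sum]
  refine Finset.sum_congr rfl fun i _ => ?_
  have hslice : ContDiff ℝ 2 (fun r : ℝ => f (x + r • EuclideanSpace.single i (1 : ℝ))) := by
    fun_prop
  simpa using iteratedDeriv_two_const_mul_add_rpow hslice c a p 0 (by simpa using hpos)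

/-- Key computation in Theorem 4.2: for `w(x,t) = c₃ (f(x) + c₂(T-t))^{-1/(l-1)}`, at every
point with `f(x) > 0` and `t < T`,
`∂w/∂t - Δₓw = (w/((l-1)(f+c₂(T-t)))) (c₂ + Δf - (l/(l-1)) ‖∇f‖²/(f+c₂(T-t)))`;
in particular `∂w/∂t - Δₓw ≥ 0` whenever `Δf - (l/(l-1))‖∇f‖²/f ≥ -c₂`. -/
theorem stmt14 (n : ℕ) (hn : 1 ≤ n) (l c₂ c₃ T : ℝ) (hl : 1 < l) (hc₂ : 0 < c₂)
    (hc₃ : 0 < c₃)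
    (f : EuclideanSpace ℝ (Fin n) → ℝ) (hf : ContDiff ℝ 2 f)
    (w : EuclideanSpace ℝ (Fin n) → ℝ → ℝ)
    (hw : ∀ x t, w x t = c₃ * (f x + c₂ * (T - t)) ^ (-(1 / (l - 1)))) :
    ∀ (x : EuclideanSpace ℝ (Fin n)) (t : ℝ), 0 < f x → t < T →
      (deriv (w x) t - euclLaplacian (fun y => w y t) x =
        (w x t / ((l - 1) * (f x + c₂ * (T - t)))) *
          (c₂ + euclLaplacian f x -
            (l / (l - 1)) * ‖gradient f x‖ ^ 2 / (f x + c₂ * (T - t)))) ∧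
      (-c₂ ≤ euclLaplacian f x - (l / (l - 1)) * ‖gradient f x‖ ^ 2 / f x →
        0 ≤ deriv (w x) t - euclLaplacian (fun y => w y t) x) := by
  intro x t hfx ht
  have hl' : 0 < l - 1 := sub_pos.mpr hl
  have hs : 0 < c₂ * (T - t) := mul_pos hc₂ (sub_pos.mpr ht)
  have hu : 0 < f x + c₂ * (T - t) := add_pos hfx hs
  have htime : deriv (w x) t =
      c₃ * (-c₂ * (-(1 / (l - 1))) * (f x + c₂ * (T - t)) ^ (-(1 / (l - 1)) - 1)) := by
    rw [show w x = fun s => c₃ * (f x + c₂ * (T - s)) ^ (-(1 / (l - 1))) from funext (hw x)]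
    have hd : HasDerivAt (fun s => f x + c₂ * (T - s)) (-c₂) t := by
      simpa using (((hasDerivAt_id t).const_sub T).const_mul c₂).const_add (f x)
    exact ((hd.rpow_const (Or.inl hu.ne')).const_mul c₃).deriv
  have hformula : deriv (w x) t - euclLaplacian (fun y => w y t) x =
      (w x t / ((l - 1) * (f x + c₂ * (T - t)))) *
        (c₂ + euclLaplacian f x -
          (l / (l - 1)) * ‖gradient f x‖ ^ 2 / (f x + c₂ * (T - t))) := by
    rw [htime]
    simp only [hw]
    rw [euclLaplacian_const_mul_add_rpow hf c₃ _ _ x hu, Real.rpow_sub_one hu.ne']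
    field_simp
    ring
  refine ⟨hformula, fun h => ?_⟩
  rw [hformula, hw]
  have hgrad : l / (l - 1) * ‖gradient f x‖ ^ 2 / (f x + c₂ * (T - t)) ≤
      l / (l - 1) * ‖gradient f x‖ ^ 2 / f x :=
    div_le_div_of_nonneg_left (by positivity) hfx (le_add_of_nonneg_right hs.le)
  exact mul_nonneg (by positivity) (by linarith)
end

section
/- Let 0 < p < 1, b > 0, c₀ > 0, τ > 0, and suppose 0 < f₀ < (c₀·b^p·(1 − e^{(p−1)τ/b}))^{1/(1−p)}. Define f(t) = e^{t/b}·(max(f₀^{1−p} − c₀·b^p·(1 − e^{(p−1)t/b}), 0))^{1/(1−p)}. Then f(t) = 0 for all t ≥ τ, and at every t ≥ 0 with f₀^{1−p} − c₀·b^p·(1 − e^{(p−1)t/b}) > 0 the function f is differentiable with f'(t) = f(t)/b − c₀·b^{p−1}·f(t)^p. -/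
open Set

/-- Explicit extinct solution of `f' = f/b - c₀ b^{p-1} f^p` in Theorem 3.1: for `0 < p < 1`
and `f₀` small, `f(t) = e^{t/b} (max (f₀^{1-p} - c₀ b^p (1 - e^{(p-1)t/b})) 0)^{1/(1-p)}`
vanishes for `t ≥ τ`, and wherever the base is positive `f' = f/b - c₀ b^{p-1} f^p`. -/
theorem stmt15 (p b c₀ τ f₀ : ℝ) (hp0 : 0 < p) (hp1 : p < 1) (hb : 0 < b) (hc₀ : 0 < c₀)
    (hτ : 0 < τ) (hf₀ : 0 < f₀)
    (hsmall : f₀ < (c₀ * b ^ p * (1 - Real.exp ((p - 1) * τ / b))) ^ (1 / (1 - p)))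
    (f : ℝ → ℝ)
    (hf : ∀ t, f t = Real.exp (t / b) *
      (max (f₀ ^ (1 - p) - c₀ * b ^ p * (1 - Real.exp ((p - 1) * t / b))) 0) ^ (1 / (1 - p))) :
    (∀ t ≥ τ, f t = 0) ∧
    (∀ t ≥ (0 : ℝ), 0 < f₀ ^ (1 - p) - c₀ * b ^ p * (1 - Real.exp ((p - 1) * t / b)) →
      HasDerivAt f (f t / b - c₀ * b ^ (p - 1) * f t ^ p) t) := by
  have hp : 0 < 1 - p := by linarith
  constructor
  · intro t ht
    have hexp : Real.exp ((p - 1) * t / b) ≤ Real.exp ((p - 1) * τ / b) := by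
      apply Real.exp_le_exp.mpr
      gcongr ?_ / b
      nlinarith
    have hlt : Real.exp ((p - 1) * τ / b) < 1 := by
      rw [Real.exp_lt_one_iff]
      exact div_neg_of_neg_of_pos (mul_neg_of_neg_of_pos (by linarith) hτ) hb
    have hA : 0 < c₀ * b ^ p := by positivity
    have hpow : f₀ ^ (1 - p) < c₀ * b ^ p * (1 - Real.exp ((p - 1) * τ / b)) := by
      have hbase : 0 ≤ c₀ * b ^ p * (1 - Real.exp ((p - 1) * τ / b)) :=
        mul_nonneg hA.le (by linarith)
      have h := Real.rpow_lt_rpow hf₀.le hsmall hp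
      rwa [← Real.rpow_mul hbase, one_div_mul_cancel hp.ne', Real.rpow_one] at h
    have hnonpos : f₀ ^ (1 - p) - c₀ * b ^ p * (1 - Real.exp ((p - 1) * t / b)) ≤ 0 := by
      nlinarith
    rw [hf, max_eq_right hnonpos, Real.zero_rpow (one_div_pos.mpr hp).ne', mul_zero]
  · intro t _ hpos
    set g : ℝ → ℝ := fun s ↦ f₀ ^ (1 - p) - c₀ * b ^ p * (1 - Real.exp ((p - 1) * s / b))
    change 0 < g t at hpos
    have hgder : HasDerivAt g (c₀ * b ^ p * (Real.exp ((p - 1) * t / b) * ((p - 1) / b))) t := by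
      have h := ((((((hasDerivAt_id t).const_mul (p - 1)).div_const b).exp).const_sub 1).const_mul
        (c₀ * b ^ p)).const_sub (f₀ ^ (1 - p))
      refine h.congr_deriv ?_
      simp only [id]
      ring
    have hfg : ∀ᶠ s in nhds t, f s = Real.exp (s / b) * g s ^ (1 / (1 - p)) := by
      filter_upwards [hgder.continuousAt.eventually (lt_mem_nhds hpos)] with s hs
      rw [hf, ← max_eq_left hs.le]
    have hder := (((hasDerivAt_id t).div_const b).exp.mul
      (hgder.rpow_const (p := 1 / (1 - p)) (Or.inl hpos.ne'))).congr_of_eventuallyEq hfg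
    refine hder.congr_deriv ?_
    have hexponent : 1 / (1 - p) * p = 1 / (1 - p) - 1 := by
      field_simp
      ring
    have hexp : Real.exp (t / b * p) = Real.exp (t / b) * Real.exp ((p - 1) * t / b) := by
      rw [← Real.exp_add]
      congr 1
      ring
    have hfp : f t ^ p = Real.exp (t / b) * Real.exp ((p - 1) * t / b) *
        g t ^ (1 / (1 - p) - 1) := by
      rw [hfg.self_of_nhds, Real.mul_rpow (Real.exp_pos _).le (Real.rpow_nonneg hpos.le _),
        ← Real.exp_mul, ← Real.rpow_mul hpos.le, hexponent, hexp]
    rw [hfp, hfg.self_of_nhds, Real.rpow_sub_one hb.ne']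
    simp only [id]
    field_simp
    ring
end
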